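/- The Sinkhorn limit map Φ is continuous: if M and M^ε are admissible n×n matrices with at least one positive diagonal, then Φ(M^ε) converges to Φ(M) as M^ε converges to M, where convergence of matrices is measured by the distance d(A,B) = max_{i,j} |a_{ij} − b_{ij}|. -/

import Mathlib

open Matrix Filter

/-- A matrix is admissible if it has nonnegative entries and no zero row or column. -/
def Admissible {u v : ℕ} (M : Matrix (Fin u) (Fin v) ℝ) : Prop :=
  (∀ i j, 0 ≤ M i j) ∧ (∀ i, ∃ j, M i j ≠ 0) ∧ (∀ j, ∃ i, M i j ≠ 0)

/-- Row normalization. -/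
noncomputable def rowNorm {u v : ℕ} (A : Matrix (Fin u) (Fin v) ℝ) : Matrix (Fin u) (Fin v) ℝ :=
  Matrix.of fun i j => A i j / ∑ k, A i k

/-- Column normalization. -/
noncomputable def colNorm {u v : ℕ} (A : Matrix (Fin u) (Fin v) ℝ) : Matrix (Fin u) (Fin v) ℝ :=
  Matrix.of fun i j => A i j / ∑ k, A k j

/-- A pair (P,Q) is stable if C(P) = Q and R(Q) = P. -/
def Stable {u v : ℕ} (P Q : Matrix (Fin u) (Fin v) ℝ) : Prop :=
  colNorm P = Q ∧ rowNorm Q = P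

/-- The row-normalized Sinkhorn iterates: `skL M 0 = R(M)`, `skL M (k+1) = R(C(skL M k))`. -/
noncomputable def skL {u v : ℕ} (M : Matrix (Fin u) (Fin v) ℝ) : ℕ → Matrix (Fin u) (Fin v) ℝ
  | 0 => rowNorm M
  | k + 1 => rowNorm (colNorm (skL M k))

/-- The column-normalized Sinkhorn iterates: `skT M k = C(skL M k)`. -/
noncomputable def skT {u v : ℕ} (M : Matrix (Fin u) (Fin v) ℝ) (k : ℕ) : Matrix (Fin u) (Fin v) ℝ :=
  colNorm (skL M k)

/-- Entrywise convergence of a sequence of matrices. -/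
def EntrywiseLimit {u v : ℕ} (f : ℕ → Matrix (Fin u) (Fin v) ℝ)
    (L : Matrix (Fin u) (Fin v) ℝ) : Prop :=
  ∀ i j, Filter.Tendsto (fun k => f k i j) Filter.atTop (nhds (L i j))

/-- `PartialPattern B A` means `B ≺ A` : every zero of `A` is a zero of `B`. -/
def PartialPattern {u v : ℕ} (B A : Matrix (Fin u) (Fin v) ℝ) : Prop :=
  ∀ i j, A i j = 0 → B i j = 0

/-- Product of the diagonal of `A` determined by the permutation `σ`. -/
noncomputable def diagProd {n : ℕ} (A : Matrix (Fin n) (Fin n) ℝ) (σ : Equiv.Perm (Fin n)) : ℝ :=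
  ∏ i, A i (σ i)

/-- `A` has at least one positive diagonal. -/
def HasPosDiag {n : ℕ} (A : Matrix (Fin n) (Fin n) ℝ) : Prop :=
  ∃ σ : Equiv.Perm (Fin n), ∀ i, 0 < A i (σ i)

/-- The entry at position `(i,j)` is contained in some positive diagonal of `A`. -/
def OnDiag {n : ℕ} (A : Matrix (Fin n) (Fin n) ℝ) (i j : Fin n) : Prop :=
  ∃ σ : Equiv.Perm (Fin n), (∀ k, 0 < A k (σ k)) ∧ σ i = j

/-- `A` has total support : every positive entry is on-diagonal. -/
def TotalSupport {n : ℕ} (A : Matrix (Fin n) (Fin n) ℝ) : Prop :=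
  ∀ i j, 0 < A i j → OnDiag A i j

/-- Doubly stochastic matrices. -/
def DoublyStochastic {n : ℕ} (A : Matrix (Fin n) (Fin n) ℝ) : Prop :=
  (∀ i j, 0 ≤ A i j) ∧ (∀ i, ∑ j, A i j = 1) ∧ (∀ j, ∑ i, A i j = 1)

/-- Cross ratio equivalence of square matrices. -/
def CrossRatioEquiv {n : ℕ} (A B : Matrix (Fin n) (Fin n) ℝ) : Prop :=
  (∀ σ : Equiv.Perm (Fin n), diagProd A σ ≠ 0 ↔ diagProd B σ ≠ 0) ∧
  ∀ σ σ' : Equiv.Perm (Fin n), diagProd A σ ≠ 0 → diagProd A σ' ≠ 0 →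
    diagProd A σ / diagProd A σ' = diagProd B σ / diagProd B σ'

section helpers

theorem diagProd_rowNorm {n : ℕ} (A : Matrix (Fin n) (Fin n) ℝ) (σ : Equiv.Perm (Fin n)) :
    diagProd (rowNorm A) σ = diagProd A σ / ∏ i, ∑ k, A i k := by
  simp [diagProd, rowNorm, Finset.prod_div_distrib]

theorem diagProd_colNorm {n : ℕ} (A : Matrix (Fin n) (Fin n) ℝ) (σ : Equiv.Perm (Fin n)) :
    diagProd (colNorm A) σ = diagProd A σ / ∏ j, ∑ k, A k j := by
  simp only [diagProd, colNorm, Finset.prod_div_distrib, Matrix.of_apply]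
  rw [Equiv.prod_comp σ (fun j => ∑ k, A k j)]

theorem diagProd_skL {n : ℕ} (M : Matrix (Fin n) (Fin n) ℝ) (k : ℕ) :
    ∃ c : ℝ, ∀ σ, diagProd (skL M k) σ = c * diagProd M σ := by
  induction k with
  | zero =>
    refine ⟨(∏ i, ∑ k, M i k)⁻¹, fun σ => ?_⟩
    rw [skL, diagProd_rowNorm]; ring
  | succ k ih =>
    obtain ⟨c, hc⟩ := ih
    refine ⟨(∏ i, ∑ l, colNorm (skL M k) i l)⁻¹ * (∏ j, ∑ l, skL M k l j)⁻¹ * c, fun σ => ?_⟩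
    rw [skL, diagProd_rowNorm, diagProd_colNorm, hc]; ring

/-- Nonnegative with positive diagonal `σ`. -/
def Good {n : ℕ} (A : Matrix (Fin n) (Fin n) ℝ) (σ : Equiv.Perm (Fin n)) : Prop :=
  (∀ i j, 0 ≤ A i j) ∧ ∀ i, 0 < A i (σ i)

theorem Good.row_pos {n : ℕ} {A : Matrix (Fin n) (Fin n) ℝ} {σ : Equiv.Perm (Fin n)}
    (h : Good A σ) (i : Fin n) : 0 < ∑ k, A i k :=
  Finset.sum_pos' (fun k _ => h.1 i k) ⟨σ i, Finset.mem_univ _, h.2 i⟩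

theorem Good.col_pos {n : ℕ} {A : Matrix (Fin n) (Fin n) ℝ} {σ : Equiv.Perm (Fin n)}
    (h : Good A σ) (j : Fin n) : 0 < ∑ k, A k j :=
  Finset.sum_pos' (fun k _ => h.1 k j) ⟨σ.symm j, Finset.mem_univ _, by
    simpa using h.2 (σ.symm j)⟩

theorem Good.rowNorm {n : ℕ} {A : Matrix (Fin n) (Fin n) ℝ} {σ : Equiv.Perm (Fin n)}
    (h : Good A σ) : Good (rowNorm A) σ :=
  ⟨fun i j => div_nonneg (h.1 i j) (h.row_pos i).le, fun i => div_pos (h.2 i) (h.row_pos i)⟩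

theorem Good.colNorm {n : ℕ} {A : Matrix (Fin n) (Fin n) ℝ} {σ : Equiv.Perm (Fin n)}
    (h : Good A σ) : Good (colNorm A) σ :=
  ⟨fun i j => div_nonneg (h.1 i j) (h.col_pos j).le, fun i => div_pos (h.2 i) (h.col_pos _)⟩

theorem Good.rowNorm_sum {n : ℕ} {A : Matrix (Fin n) (Fin n) ℝ} {σ : Equiv.Perm (Fin n)}
    (h : Good A σ) (i : Fin n) : ∑ j, _root_.rowNorm A i j = 1 := by
  simp only [_root_.rowNorm, Matrix.of_apply, ← Finset.sum_div]
  exact div_self (h.row_pos i).ne'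

theorem Good.colNorm_sum {n : ℕ} {A : Matrix (Fin n) (Fin n) ℝ} {σ : Equiv.Perm (Fin n)}
    (h : Good A σ) (j : Fin n) : ∑ i, _root_.colNorm A i j = 1 := by
  simp only [_root_.colNorm, Matrix.of_apply, ← Finset.sum_div]
  exact div_self (h.col_pos j).ne'

theorem Good.skL {n : ℕ} {A : Matrix (Fin n) (Fin n) ℝ} {σ : Equiv.Perm (Fin n)}
    (h : Good A σ) (k : ℕ) : Good (skL A k) σ ∧ ∀ i, ∑ j, _root_.skL A k i j = 1 := by
  induction k with
  | zero => exact ⟨h.rowNorm, h.rowNorm_sum⟩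
  | succ k ih => exact ⟨ih.1.colNorm.rowNorm, ih.1.colNorm.rowNorm_sum⟩

theorem limit_ds {n : ℕ} {M P : Matrix (Fin n) (Fin n) ℝ} (hM : Admissible M)
    (hpd : HasPosDiag M) (hL : EntrywiseLimit (skL M) P) (hT : EntrywiseLimit (skT M) P) :
    DoublyStochastic P := by
  obtain ⟨σ, hσ⟩ := hpd
  have hg : Good M σ := ⟨hM.1, hσ⟩
  refine ⟨fun i j => ge_of_tendsto' (hL i j) fun k => (hg.skL k).1.1 i j, fun i => ?_, fun j => ?_⟩
  · refine tendsto_nhds_unique (tendsto_finsetSum Finset.univ fun j _ => hL i j) ?_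
    simp only [(hg.skL _).2 i]
    exact tendsto_const_nhds
  · refine tendsto_nhds_unique (tendsto_finsetSum Finset.univ fun i _ => hT i j) ?_
    have : ∀ k, ∑ i, skT M k i j = 1 := fun k => (hg.skL k).1.colNorm_sum j
    simp only [this]
    exact tendsto_const_nhds

theorem limit_cross {n : ℕ} {M P : Matrix (Fin n) (Fin n) ℝ}
    (hL : EntrywiseLimit (skL M) P) (σ τ : Equiv.Perm (Fin n)) :
    diagProd P σ * diagProd M τ = diagProd P τ * diagProd M σ := by
  have h : ∀ σ, Tendsto (fun k => diagProd (skL M k) σ) atTop (nhds (diagProd P σ)) := fun σ =>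
    tendsto_finsetProd Finset.univ fun i _ => hL i (σ i)
  refine tendsto_nhds_unique ((h σ).mul_const _) (((h τ).mul_const (diagProd M σ)).congr ?_)
  intro k
  obtain ⟨c, hc⟩ := diagProd_skL M k
  rw [hc, hc]; ring

theorem birkhoff {n : ℕ} {P : Matrix (Fin n) (Fin n) ℝ} (h : DoublyStochastic P) :
    ∃ w : Equiv.Perm (Fin n) → ℝ, (∀ σ, 0 ≤ w σ) ∧ ∑ σ, w σ = 1 ∧
      (∀ i j, P i j = ∑ σ, w σ * if σ i = j then 1 else 0) ∧
      ∀ σ, 0 < w σ → ∀ i, 0 < P i (σ i) := by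
  obtain ⟨w, h0, h1, h2⟩ := exists_eq_sum_perm_of_mem_doublyStochastic
    (mem_doublyStochastic_iff_sum.2 h)
  have h3 : ∀ i j, P i j = ∑ σ, w σ * if σ i = j then 1 else 0 := by
    intro i j
    rw [← h2, Matrix.sum_apply]
    refine Finset.sum_congr rfl fun σ _ => ?_
    simp [Equiv.Perm.permMatrix, PEquiv.toMatrix_apply, Equiv.toPEquiv_apply, eq_comm]
  refine ⟨w, h0, h1, h3, fun σ hσ i => ?_⟩
  rw [h3]
  refine Finset.sum_pos' (fun τ _ => mul_nonneg (h0 τ) (by split_ifs <;> norm_num))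
    ⟨σ, Finset.mem_univ _, by simpa using hσ⟩

theorem diagProd_pos {n : ℕ} {P : Matrix (Fin n) (Fin n) ℝ} (h0 : ∀ i j, 0 ≤ P i j)
    (σ : Equiv.Perm (Fin n)) : 0 < diagProd P σ ↔ ∀ i, 0 < P i (σ i) := by
  constructor
  · intro h i
    refine lt_of_le_of_ne (h0 _ _) fun h' => h.ne' ?_
    exact Finset.prod_eq_zero (Finset.mem_univ i) h'.symm
  · intro h
    exact Finset.prod_pos fun i _ => h i

theorem supp_le {n : ℕ} {P Q : Matrix (Fin n) (Fin n) ℝ} (hP : DoublyStochastic P)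
    (h : ∀ σ : Equiv.Perm (Fin n), (∀ i, 0 < P i (σ i)) → ∀ i, 0 < Q i (σ i))
    (i j : Fin n) (hij : 0 < P i j) : 0 < Q i j := by
  obtain ⟨w, h0, -, h3, h4⟩ := birkhoff hP
  rw [h3] at hij
  obtain ⟨σ, -, hσ⟩ := Finset.exists_lt_of_sum_lt (s := Finset.univ) (f := fun _ => (0:ℝ))
    (by simpa using hij)
  split_ifs at hσ with he
  · subst he
    exact h σ (h4 σ (by simpa using hσ)) i
  · simp at hσ

theorem sum_log {n : ℕ} {P : Matrix (Fin n) (Fin n) ℝ} (hP : DoublyStochastic P)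
    (F : Fin n → Fin n → ℝ) (K : ℝ) (h : ∀ σ : Equiv.Perm (Fin n), (∀ i, 0 < P i (σ i)) →
      ∑ i, F i (σ i) = K) : ∑ i, ∑ j, P i j * F i j = K := by
  obtain ⟨w, h0, h1, h3, h4⟩ := birkhoff hP
  calc ∑ i, ∑ j, P i j * F i j
      = ∑ i, ∑ j, ∑ σ, w σ * (if σ i = j then F i j else 0) := by
        refine Finset.sum_congr rfl fun i _ => Finset.sum_congr rfl fun j _ => ?_
        rw [h3, Finset.sum_mul]
        refine Finset.sum_congr rfl fun σ _ => ?_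
        split_ifs <;> simp
    _ = ∑ i, ∑ σ, w σ * F i (σ i) := by
        refine Finset.sum_congr rfl fun i _ => ?_
        rw [Finset.sum_comm]
        refine Finset.sum_congr rfl fun σ _ => ?_
        rw [← Finset.mul_sum]; simp
    _ = ∑ σ, w σ * K := by
        rw [Finset.sum_comm]
        refine Finset.sum_congr rfl fun σ _ => ?_
        rw [← Finset.mul_sum]
        rcases (h0 σ).eq_or_lt with hz | hz
        · rw [← hz]; simp
        · rw [h σ (h4 σ hz)]
    _ = K := by rw [← Finset.sum_mul, h1, one_mul]

theorem log_mono_aux {p q : ℝ} (hp : 0 ≤ p) (hq : 0 ≤ q) (h : 0 < p ↔ 0 < q) :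
    0 ≤ (p - q) * (Real.log p - Real.log q) ∧
      ((p - q) * (Real.log p - Real.log q) = 0 → p = q) := by
  rcases hp.eq_or_lt with hp0 | hp0
  · have : q = 0 := le_antisymm (not_lt.1 fun hh => by have := h.2 hh; linarith) hq
    subst this; subst hp0; simp
  · have hq0 := h.1 hp0
    rcases lt_trichotomy p q with hl | hl | hl
    · have := mul_pos_of_neg_of_neg (sub_neg.2 hl) (sub_neg.2 (Real.log_lt_log hp0 hl))
      exact ⟨this.le, fun h => absurd h this.ne'⟩
    · subst hl; simp
    · have := mul_pos (sub_pos.2 hl) (sub_pos.2 (Real.log_lt_log hq0 hl))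
      exact ⟨this.le, fun h => absurd h this.ne'⟩

theorem diag_iff {n : ℕ} {M P : Matrix (Fin n) (Fin n) ℝ} (hM : ∀ i j, 0 ≤ M i j)
    (hpd : HasPosDiag M) (hP : DoublyStochastic P)
    (h : ∀ σ τ, diagProd P σ * diagProd M τ = diagProd P τ * diagProd M σ) :
    ∃ c, 0 < c ∧ ∀ σ, diagProd P σ = c * diagProd M σ := by
  obtain ⟨σ, hσ⟩ := hpd
  rw [← diagProd_pos hM] at hσ
  obtain ⟨w, h0, h1, -, h4⟩ := birkhoff hP
  have : ∃ τ, 0 < w τ := by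
    by_contra! hc
    have : ∑ σ, w σ ≤ 0 := Finset.sum_nonpos fun τ _ => hc τ
    linarith
  obtain ⟨τ, hτ⟩ := this
  have hPτ := (diagProd_pos hP.1 τ).2 (h4 τ hτ)
  have hPσ : 0 ≤ diagProd P σ := Finset.prod_nonneg fun i _ => hP.1 _ _
  have hPσ' : 0 < diagProd P σ := by
    refine lt_of_le_of_ne hPσ fun h' => ?_
    have := h τ σ
    rw [← h', zero_mul] at this
    exact (mul_pos hPτ hσ).ne' this
  refine ⟨diagProd P σ / diagProd M σ, div_pos hPσ' hσ, fun ρ => ?_⟩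
  have := h ρ σ
  field_simp
  linarith

theorem ds_unique {n : ℕ} {P Q : Matrix (Fin n) (Fin n) ℝ} (hP : DoublyStochastic P)
    (hQ : DoublyStochastic Q) (c : ℝ) (hc : 0 < c)
    (h : ∀ σ, diagProd P σ = c * diagProd Q σ) : P = Q := by
  have hiff : ∀ σ : Equiv.Perm (Fin n), (∀ i, 0 < P i (σ i)) ↔ ∀ i, 0 < Q i (σ i) := by
    intro σ
    rw [← diagProd_pos hP.1, ← diagProd_pos hQ.1, h]
    exact mul_pos_iff_of_pos_left hc
  have hs : ∀ i j, 0 < P i j ↔ 0 < Q i j := fun i j =>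
    ⟨supp_le hP (fun σ => (hiff σ).1) i j, supp_le hQ (fun σ => (hiff σ).2) i j⟩
  have hlog : ∀ σ : Equiv.Perm (Fin n), (∀ i, 0 < P i (σ i)) →
      ∑ i, (Real.log (P i (σ i)) - Real.log (Q i (σ i))) = Real.log c := by
    intro σ hσ
    have hq := (hiff σ).1 hσ
    rw [Finset.sum_sub_distrib, ← Real.log_prod (fun i _ => (hσ i).ne'),
      ← Real.log_prod (fun i _ => (hq i).ne')]
    change Real.log (diagProd P σ) - Real.log (diagProd Q σ) = _
    rw [h, Real.log_mul hc.ne' ((diagProd_pos hQ.1 σ).2 hq).ne']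
    ring
  have e1 := sum_log hP (fun i j => Real.log (P i j) - Real.log (Q i j)) _ hlog
  have e2 := sum_log hQ (fun i j => Real.log (P i j) - Real.log (Q i j)) _
    fun σ hσ => hlog σ ((hiff σ).2 hσ)
  have e3 : ∑ i, ∑ j, (P i j - Q i j) * (Real.log (P i j) - Real.log (Q i j)) = 0 := by
    simp only [sub_mul (P _ _), Finset.sum_sub_distrib]
    linarith
  have aux := fun i j => log_mono_aux (hP.1 i j) (hQ.1 i j) (hs i j)
  rw [Finset.sum_eq_zero_iff_of_nonneg
    fun i _ => Finset.sum_nonneg fun j _ => (aux i j).1] at e3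
  ext i j
  have e4 := e3 i (Finset.mem_univ _)
  rw [Finset.sum_eq_zero_iff_of_nonneg fun j _ => (aux i j).1] at e4
  exact (aux i j).2 (e4 j (Finset.mem_univ _))

end helpers

/-- Continuity of the Sinkhorn limit map Φ, in the max-entrywise distance:
for every δ > 0 there is ε > 0 such that any admissible matrix M' with a positive
diagonal that is entrywise within ε of M has its Sinkhorn limit entrywise within δ
of that of M. -/
theorem sinkhorn_limit_continuous (n : ℕ) (M PhiM : Matrix (Fin n) (Fin n) ℝ)
    (hM : Admissible M) (hpd : HasPosDiag M)
    (hL : EntrywiseLimit (skL M) PhiM) (hT : EntrywiseLimit (skT M) PhiM) :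
    ∀ δ : ℝ, 0 < δ → ∃ ε : ℝ, 0 < ε ∧
      ∀ M' PhiM' : Matrix (Fin n) (Fin n) ℝ,
        Admissible M' → HasPosDiag M' →
        EntrywiseLimit (skL M') PhiM' → EntrywiseLimit (skT M') PhiM' →
        (∀ i j, |M' i j - M i j| < ε) →
        ∀ i j, |PhiM' i j - PhiM i j| < δ := by
  intro δ hδ
  by_contra! hcon
  choose A P hA hApd hAL hAT hAM hbad using fun m : ℕ => hcon (1 / ((m : ℝ) + 1)) (by positivity)
  have hds := fun m => limit_ds (hA m) (hApd m) (hAL m) (hAT m)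
  have hAlim : ∀ i j, Tendsto (fun m => A m i j) atTop (nhds (M i j)) := by
    intro i j
    rw [tendsto_iff_dist_tendsto_zero]
    refine squeeze_zero (fun _ => dist_nonneg) (fun m => ?_) tendsto_one_div_add_atTop_nhds_zero_nat
    rw [Real.dist_eq]
    exact (hAM m i j).le
  have hK : IsCompact (Set.univ.pi fun _ : Fin n => Set.univ.pi fun _ : Fin n =>
      Set.Icc (0 : ℝ) 1) :=
    isCompact_univ_pi fun _ => isCompact_univ_pi fun _ => isCompact_Icc
  let P' : ℕ → Fin n → Fin n → ℝ := fun m i j => P m i j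
  obtain ⟨L, -, φ, hφ, hlim⟩ := hK.tendsto_subseq (x := P')
    (fun m i _ j _ => ⟨(hds m).1 i j, by
      rw [← (hds m).2.1 i]
      exact Finset.single_le_sum (f := fun j => P m i j) (fun j _ => (hds m).1 i j)
        (Finset.mem_univ j)⟩)
  have hl : ∀ i j, Tendsto (fun m => P (φ m) i j) atTop (nhds (L i j)) := fun i j =>
    tendsto_pi_nhds.1 (tendsto_pi_nhds.1 hlim i) j
  have hLds : DoublyStochastic (L : Matrix (Fin n) (Fin n) ℝ) := by
    refine ⟨fun i j => ge_of_tendsto' (hl i j) fun m => (hds _).1 i j, fun i => ?_, fun j => ?_⟩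
    · refine tendsto_nhds_unique (tendsto_finsetSum Finset.univ fun j _ => hl i j) ?_
      simp only [(hds _).2.1 i]
      exact tendsto_const_nhds
    · refine tendsto_nhds_unique (tendsto_finsetSum Finset.univ fun i _ => hl i j) ?_
      simp only [(hds _).2.2 j]
      exact tendsto_const_nhds
  have hLc : ∀ σ τ, diagProd (L : Matrix (Fin n) (Fin n) ℝ) σ * diagProd M τ
      = diagProd (L : Matrix (Fin n) (Fin n) ℝ) τ * diagProd M σ := by
    intro σ τ
    have h1 : ∀ σ, Tendsto (fun m => diagProd (P (φ m)) σ) atTop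
        (nhds (diagProd (L : Matrix (Fin n) (Fin n) ℝ) σ)) := fun σ =>
      tendsto_finsetProd Finset.univ fun i _ => hl i (σ i)
    have h2 : ∀ σ, Tendsto (fun m => diagProd (A (φ m)) σ) atTop (nhds (diagProd M σ)) := fun σ =>
      tendsto_finsetProd Finset.univ fun i _ => (hAlim i (σ i)).comp hφ.tendsto_atTop
    refine tendsto_nhds_unique ((h1 σ).mul (h2 τ)) (((h1 τ).mul (h2 σ)).congr fun m => ?_)
    exact (limit_cross (hAL (φ m)) σ τ).symm
  have hMds := limit_ds hM hpd hL hT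
  obtain ⟨c, hc, hc'⟩ := diag_iff hM.1 hpd hLds hLc
  obtain ⟨d, hd, hd'⟩ := diag_iff hM.1 hpd hMds (limit_cross hL)
  have heq : (L : Matrix (Fin n) (Fin n) ℝ) = PhiM := by
    refine ds_unique hLds hMds (c / d) (div_pos hc hd) fun σ => ?_
    rw [hc', hd']
    field_simp
  have hev : ∀ᶠ m in atTop, ∀ i j, |P (φ m) i j - PhiM i j| < δ := by
    refine eventually_all.2 fun i => eventually_all.2 fun j => ?_
    have := hl i j
    rw [heq] at this
    exact (Metric.tendsto_nhds.1 this δ hδ)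
  obtain ⟨m, hm⟩ := hev.exists
  obtain ⟨i, j, hij⟩ := hbad (φ m)
  exact absurd (hm i j) (not_lt.2 hij)
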